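/- Let B and B' be nonempty sets. For each b ∈ B, let s_b ∈ ℤ_B be an element with zero coefficient on b, and let S_b be the subgroup of ℤ_B generated by {b, s_b}; similarly, for each b' ∈ B', let s'_{b'} ∈ ℤ_{B'} have zero coefficient on b' and let S'_{b'} be the subgroup of ℤ_{B'} generated by {b', s'_{b'}}. Then the quandles Q(S) and Q(S') are isomorphic if and only if there is a bijection f : B → B' such that for every b ∈ B, the induced homomorphism f : ℤ_B → ℤ_{B'} satisfies f(s_b) = s'_{f(b)} or f(s_b) = −s'_{f(b)}. -/

import Mathlib

/-- The disjoint union `Q(S) = ⨆ b, ℤ_B / S_b` (as a sigma type). -/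
abbrev QS {B : Type*} (S : B → AddSubgroup (FreeAbelianGroup B)) :=
  (b : B) × (FreeAbelianGroup B ⧸ S b)

/-- The quandle operation on `Q(S)`. -/
def qsOp {B : Type*} (S : B → AddSubgroup (FreeAbelianGroup B)) (x y : QS S) : QS S :=
  ⟨x.1, x.2 + QuotientAddGroup.mk (FreeAbelianGroup.of y.1)⟩

theorem FreeAbelianGroup.coeff_eq_zero_of_mem_closure {B : Type*} {b : B} {z : FreeAbelianGroup B}
    (hz : z ∈ AddSubgroup.closure (FreeAbelianGroup.of '' {c : B | c ≠ b})) :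
    FreeAbelianGroup.coeff b z = 0 := by
  induction hz using AddSubgroup.closure_induction with
  | mem x hx =>
    obtain ⟨c, hc, rfl⟩ := hx
    simpa [FreeAbelianGroup.coeff] using Finsupp.single_eq_of_ne' hc
  | zero => simp
  | add x y _ _ hx hy => simp [hx, hy]
  | neg x _ hx => simp [hx]

theorem FreeAbelianGroup.coeff_of_self {B : Type*} (b : B) :
    FreeAbelianGroup.coeff b (FreeAbelianGroup.of b) = 1 := by
  simp [FreeAbelianGroup.coeff]

theorem FreeAbelianGroup.map_mem_closure_of_injective {B B' : Type*} {f : B → B'}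
    (hf : Function.Injective f) {b : B} {z : FreeAbelianGroup B}
    (hz : z ∈ AddSubgroup.closure (FreeAbelianGroup.of '' {c : B | c ≠ b})) :
    FreeAbelianGroup.map f z ∈ AddSubgroup.closure (FreeAbelianGroup.of '' {c : B' | c ≠ f b}) := by
  induction hz using AddSubgroup.closure_induction with
  | mem x hx =>
    obtain ⟨c, hc, rfl⟩ := hx
    exact AddSubgroup.subset_closure ⟨f c, hf.ne hc, (FreeAbelianGroup.map_of_apply c).symm⟩
  | zero => simp
  | add x y _ _ hx hy => simpa using add_mem hx hy
  | neg x _ hx => simpa using hx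

/-- An element of the subgroup generated by `b` and `s`, both it and `s` having zero coefficient
on `b`, is a multiple of `s`. -/
theorem FreeAbelianGroup.exists_zsmul_of_mem_closure_pair {B : Type*} {b : B}
    {s t : FreeAbelianGroup B} (hs : FreeAbelianGroup.coeff b s = 0)
    (ht : FreeAbelianGroup.coeff b t = 0)
    (h : t ∈ AddSubgroup.closure {FreeAbelianGroup.of b, s}) : ∃ n : ℤ, n • s = t := by
  obtain ⟨m, n, rfl⟩ := AddSubgroup.mem_closure_pair.1 h
  have hm : m = 0 := by simpa [hs, FreeAbelianGroup.coeff_of_self] using ht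
  exact ⟨n, by simp [hm]⟩

theorem FreeAbelianGroup.eq_or_eq_neg_of_zsmul {B : Type*} {s t : FreeAbelianGroup B} {m n : ℤ}
    (hm : m • s = t) (hn : n • t = s) : t = s ∨ t = -s := by
  have hinj := (FreeAbelianGroup.equivFinsupp B).injective
  have h : (m * n - 1) • FreeAbelianGroup.equivFinsupp B t = 0 := by
    rw [← map_zsmul, sub_smul, mul_smul, hn, hm, one_smul, sub_self, map_zero]
  rcases smul_eq_zero.1 h with h | h
  · rcases Int.eq_one_or_neg_one_of_mul_eq_one (sub_eq_zero.1 h) with rfl | rfl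
    · left; simpa using hm.symm
    · right; simpa using hm.symm
  · have ht : t = 0 := hinj (by simpa using h)
    left
    rw [← hn, ht, smul_zero]

/-- Translation of `Q(S)` by an element of `ℤ_B`. -/
def qsTranslate {B : Type*} (S : B → AddSubgroup (FreeAbelianGroup B)) (x : QS S)
    (z : FreeAbelianGroup B) : QS S :=
  ⟨x.1, x.2 + QuotientAddGroup.mk z⟩

section Translate

variable {B : Type*} {S : B → AddSubgroup (FreeAbelianGroup B)}

theorem qsTranslate_zero (x : QS S) : qsTranslate S x 0 = x := by
  simp [qsTranslate]

theorem qsTranslate_add (x : QS S) (z w : FreeAbelianGroup B) :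
    qsTranslate S x (z + w) = qsTranslate S (qsTranslate S x z) w :=
  Sigma.ext rfl (heq_of_eq (add_assoc x.2 (QuotientAddGroup.mk z) (QuotientAddGroup.mk w)).symm)

theorem qsTranslate_eq_self_iff (x : QS S) (z : FreeAbelianGroup B) :
    qsTranslate S x z = x ↔ z ∈ S x.1 := by
  obtain ⟨b, a⟩ := x
  simp [qsTranslate]

theorem exists_qsTranslate_eq (b : B) (x : FreeAbelianGroup B ⧸ S b) :
    ∃ z, (⟨b, x⟩ : QS S) = qsTranslate S ⟨b, 0⟩ z := by
  obtain ⟨z, rfl⟩ := QuotientAddGroup.mk_surjective x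
  exact ⟨z, by simp [qsTranslate]⟩

end Translate

section Hom

variable {B B' : Type*} {S : B → AddSubgroup (FreeAbelianGroup B)}
  {S' : B' → AddSubgroup (FreeAbelianGroup B')}

/-- The map on index sets induced by a map `Q(S) → Q(S')`. -/
def qsIndexMap (g : QS S → QS S') (b : B) : B' := (g ⟨b, 0⟩).1

theorem fst_apply_eq_qsIndexMap {g : QS S → QS S'}
    (hg : ∀ x y, g (qsOp S x y) = qsOp S' (g x) (g y)) (x : QS S) :
    (g x).1 = qsIndexMap g x.1 := by
  have key : ∀ (z : FreeAbelianGroup B) (x : QS S), (g (qsTranslate S x z)).1 = (g x).1 := by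
    intro z
    induction z using FreeAbelianGroup.induction_on with
    | zero => intro x; rw [qsTranslate_zero]
    | of c => intro x; exact (Sigma.ext_iff.1 (hg x ⟨c, 0⟩)).1
    | neg c h =>
      intro x
      rw [← h, ← qsTranslate_add, neg_add_cancel, qsTranslate_zero]
    | add z w hz hw => intro x; rw [qsTranslate_add, hw, hz]
  obtain ⟨b, x⟩ := x
  obtain ⟨z, hz⟩ := exists_qsTranslate_eq b x
  rw [hz, key]
  rfl

theorem map_qsTranslate {g : QS S → QS S'}
    (hg : ∀ x y, g (qsOp S x y) = qsOp S' (g x) (g y)) (x : QS S) (z : FreeAbelianGroup B) :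
    g (qsTranslate S x z) = qsTranslate S' (g x) (FreeAbelianGroup.map (qsIndexMap g) z) := by
  induction z using FreeAbelianGroup.induction_on generalizing x with
  | zero => rw [map_zero, qsTranslate_zero, qsTranslate_zero]
  | of c =>
    rw [FreeAbelianGroup.map_of_apply]
    exact hg x ⟨c, 0⟩
  | neg c h =>
    have h := h (qsTranslate S x (-FreeAbelianGroup.of c))
    rw [← qsTranslate_add, neg_add_cancel, qsTranslate_zero] at h
    rw [h, ← qsTranslate_add, ← map_add, add_neg_cancel, map_zero, qsTranslate_zero]
  | add z w hz hw => rw [qsTranslate_add, hw, hz, map_add, qsTranslate_add]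

theorem qsIndexMap_leftInverse {g : QS S → QS S'} {k : QS S' → QS S}
    (hk : ∀ x y, k (qsOp S' x y) = qsOp S (k x) (k y)) (hkg : Function.LeftInverse k g) :
    Function.LeftInverse (qsIndexMap k) (qsIndexMap g) := fun b => by
  have h := fst_apply_eq_qsIndexMap hk (g ⟨b, 0⟩)
  rw [hkg] at h
  exact h.symm

theorem mem_iff_map_qsIndexMap_mem {g : QS S → QS S'} (hinj : Function.Injective g)
    (hg : ∀ x y, g (qsOp S x y) = qsOp S' (g x) (g y)) (b : B) (z : FreeAbelianGroup B) :
    FreeAbelianGroup.map (qsIndexMap g) z ∈ S' (qsIndexMap g b) ↔ z ∈ S b := by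
  rw [← qsTranslate_eq_self_iff (⟨b, 0⟩ : QS S), ← hinj.eq_iff, map_qsTranslate hg,
    qsTranslate_eq_self_iff]
  rfl

/-- A bijection of index sets carrying each `S b` onto `S' (e b)` induces an isomorphism. -/
theorem exists_qs_equiv (e : B ≃ B')
    (h : ∀ b, (S b).map (FreeAbelianGroup.equivOfEquiv e).toAddMonoidHom = S' (e b)) :
    ∃ g : QS S ≃ QS S', ∀ x y : QS S, g (qsOp S x y) = qsOp S' (g x) (g y) := by
  refine ⟨Equiv.sigmaCongr e fun b =>
    (QuotientAddGroup.congr (S b) (S' (e b)) (FreeAbelianGroup.equivOfEquiv e) (h b)).toEquiv, ?_⟩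
  rintro ⟨b, x⟩ ⟨c, y⟩
  obtain ⟨z, rfl⟩ := QuotientAddGroup.mk_surjective x
  refine Sigma.ext rfl (heq_of_eq ?_)
  refine (map_add (QuotientAddGroup.congr (S b) (S' (e b))
    (FreeAbelianGroup.equivOfEquiv e) (h b)) _ _).trans ?_
  refine congrArg _ (congrArg QuotientAddGroup.mk ?_)
  exact FreeAbelianGroup.map_of_apply c

end Hom

/-- Corollary 2.5: with each `S_b` generated by `{b, s_b}` where `s_b ∈ ℤ_{B∖{b}}`,
and each `S'_{b'}` generated by `{b', s'_{b'}}` where `s'_{b'} ∈ ℤ_{B'∖{b'}}`,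
the quandles `Q(S)` and `Q(S')` are isomorphic if and only if there is a bijection
`f : B → B'` with `f(s_b) = ± s'_{f(b)}` for all `b ∈ B`. -/
theorem stmt6 {B B' : Type*} [Nonempty B] [Nonempty B']
    (s : B → FreeAbelianGroup B)
    (hs : ∀ b : B, s b ∈ AddSubgroup.closure (FreeAbelianGroup.of '' {c : B | c ≠ b}))
    (s' : B' → FreeAbelianGroup B')
    (hs' : ∀ b' : B', s' b' ∈ AddSubgroup.closure (FreeAbelianGroup.of '' {c : B' | c ≠ b'}))
    (S : B → AddSubgroup (FreeAbelianGroup B))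
    (hS : ∀ b : B, S b = AddSubgroup.closure {FreeAbelianGroup.of b, s b})
    (S' : B' → AddSubgroup (FreeAbelianGroup B'))
    (hS' : ∀ b' : B', S' b' = AddSubgroup.closure {FreeAbelianGroup.of b', s' b'}) :
    (∃ g : QS S ≃ QS S', ∀ x y : QS S, g (qsOp S x y) = qsOp S' (g x) (g y)) ↔
      ∃ f : B → B', Function.Bijective f ∧ ∀ b : B,
        FreeAbelianGroup.map f (s b) = s' (f b) ∨
        FreeAbelianGroup.map f (s b) = -(s' (f b)) := by
  constructor
  · rintro ⟨g, hg⟩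
    have hg' : ∀ x y, g.symm (qsOp S' x y) = qsOp S (g.symm x) (g.symm y) := fun x y => by
      rw [Equiv.symm_apply_eq, hg, g.apply_symm_apply, g.apply_symm_apply]
    have hl := qsIndexMap_leftInverse hg' g.leftInverse_symm
    have hr := qsIndexMap_leftInverse hg g.rightInverse_symm
    refine ⟨qsIndexMap g, ⟨hl.injective, hr.surjective⟩, fun b => ?_⟩
    have hmem := mem_iff_map_qsIndexMap_mem g.injective hg b
    generalize qsIndexMap g = f at hl hr hmem
    have hs'0 := FreeAbelianGroup.coeff_eq_zero_of_mem_closure (hs' (f b))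
    have ht0 := FreeAbelianGroup.coeff_eq_zero_of_mem_closure
      (FreeAbelianGroup.map_mem_closure_of_injective hl.injective (hs b))
    have ht : FreeAbelianGroup.map f (s b) ∈ S' (f b) :=
      (hmem _).2 (hS b ▸ AddSubgroup.subset_closure (by simp))
    have hs'mem : s' (f b) ∈ AddSubgroup.closure
        {FreeAbelianGroup.of (f b), FreeAbelianGroup.map f (s b)} := by
      have hz : FreeAbelianGroup.map f (FreeAbelianGroup.map (qsIndexMap g.symm) (s' (f b))) =
          s' (f b) := by
        rw [← FreeAbelianGroup.map_comp_apply, hr.comp_eq_id, FreeAbelianGroup.map_id_apply]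
      have hzS := (hmem (FreeAbelianGroup.map (qsIndexMap g.symm) (s' (f b)))).1
        (by rw [hz, hS']; exact AddSubgroup.subset_closure (by simp))
      rw [hS] at hzS
      obtain ⟨m, n, hmn⟩ := AddSubgroup.mem_closure_pair.1 hzS
      exact AddSubgroup.mem_closure_pair.2 ⟨m, n, by
        rw [← hz, ← hmn, map_add, map_zsmul, map_zsmul, FreeAbelianGroup.map_of_apply]⟩
    rw [hS'] at ht
    obtain ⟨m, hm⟩ := FreeAbelianGroup.exists_zsmul_of_mem_closure_pair hs'0 ht0 ht
    obtain ⟨n, hn⟩ := FreeAbelianGroup.exists_zsmul_of_mem_closure_pair ht0 hs'0 hs'mem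
    exact FreeAbelianGroup.eq_or_eq_neg_of_zsmul hm hn
  · rintro ⟨f, hf, h⟩
    refine exists_qs_equiv (Equiv.ofBijective f hf) fun b => ?_
    have hmap : (FreeAbelianGroup.equivOfEquiv (Equiv.ofBijective f hf)).toAddMonoidHom =
        FreeAbelianGroup.map f := rfl
    rw [hmap, Equiv.ofBijective_apply, hS, hS', AddMonoidHom.map_closure, Set.image_pair,
      FreeAbelianGroup.map_of_apply]
    rcases h b with h | h <;> rw [h]
    rw [Set.insert_eq, Set.insert_eq, AddSubgroup.closure_union, AddSubgroup.closure_union,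
      AddSubgroup.closure_singleton_neg]
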